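/- arXiv:0808.2851 — 2 statements merged into one kernel-verified Lean document; each statement's English description precedes it below -/
import Mathlib

section
/- Let r_0, r_1, r_2, r_3 ∈ M_2(ℂ) satisfy ρ_1(r_j* r_k) = δ_{jk}. Then the 4^ν elements h^{(ν)}_0, …, h^{(ν)}_{4^ν−1} of the left Haar system are nonzero, pairwise orthogonal with respect to the inner product ⟨x, y⟩ = ρ_ν(y* x) on N_ν (i.e. ρ_ν((h^{(ν)}_k)* h^{(ν)}_j) = 0 for j ≠ k), and hence form a linear basis of the 4^ν-dimensional vector space N_ν = M_{2^ν}(ℂ). -/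
open Finset
open scoped ENNReal ComplexOrder Kronecker Matrix

noncomputable section

/-- Kronecker product of square complex matrices, realized on `Fin (m * n)`. -/
def kron {m n : ℕ} (x : Matrix (Fin m) (Fin m) ℂ) (y : Matrix (Fin n) (Fin n) ℂ) :
    Matrix (Fin (m * n)) (Fin (m * n)) ℂ :=
  Matrix.reindex finProdFinEquiv finProdFinEquiv (x ⊗ₖ y)

/-- The matrix `A₁ = diag(α, 1 - α)`. -/
def A1 (α : ℝ) : Matrix (Fin 2) (Fin 2) ℂ :=
  Matrix.diagonal ![(α : ℂ), ((1 - α : ℝ) : ℂ)]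

/-- The matrix `A₁^t = diag(α^t, (1 - α)^t)` (entrywise real power on the diagonal). -/
def A1t (α t : ℝ) : Matrix (Fin 2) (Fin 2) ℂ :=
  Matrix.diagonal ![((α ^ t : ℝ) : ℂ), (((1 - α) ^ t : ℝ) : ℂ)]

/-- `Amat α ν = A_ν`, the ν-fold Kronecker power of `diag(α, 1-α)`. -/
def Amat (α : ℝ) : (ν : ℕ) → Matrix (Fin (2 ^ ν)) (Fin (2 ^ ν)) ℂ
  | 0 => 1
  | ν + 1 => kron (Amat α ν) (A1 α)

/-- `Amatt α t ν = A_ν^t`, the ν-fold Kronecker power of `diag(α^t, (1-α)^t)`. -/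
def Amatt (α t : ℝ) : (ν : ℕ) → Matrix (Fin (2 ^ ν)) (Fin (2 ^ ν)) ℂ
  | 0 => 1
  | ν + 1 => kron (Amatt α t ν) (A1t α t)

/-- The state `ρ_ν(x) = Tr (x A_ν)` on `N_ν = M_{2^ν}(ℂ)`. -/
def rho (α : ℝ) (ν : ℕ) (x : Matrix (Fin (2 ^ ν)) (Fin (2 ^ ν)) ℂ) : ℂ :=
  (x * Amat α ν).trace

/-- The state `ρ_1(x) = Tr (x A_1)` on `M_2(ℂ)`. -/
def rho1 (α : ℝ) (x : Matrix (Fin 2) (Fin 2) ℂ) : ℂ :=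
  (x * A1 α).trace

/-- The Schatten `p`-norm `‖x‖_{C_p} = (Tr ((x^* x)^{p/2}))^{1/p}`, `1 ≤ p < ∞`,
computed through the eigenvalues of the positive semidefinite matrix `x^* x`. -/
def schatten {N : ℕ} (p : ℝ) (x : Matrix (Fin N) (Fin N) ℂ) : ℝ :=
  (∑ i, ((Matrix.posSemidef_conjTranspose_mul_self x).isHermitian.eigenvalues i) ^ (p / 2)) ^
    (1 / p)

/-- The operator norm `‖x‖ = ‖x‖_{C_∞}` of a complex matrix (acting on ℓ²). -/
def opNorm {N : ℕ} (x : Matrix (Fin N) (Fin N) ℂ) : ℝ :=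
  ‖Matrix.toEuclideanCLM (𝕜 := ℂ) x‖

/-- The left predual norm `‖x‖_♯ = ‖x A_ν‖_{C_1}` on `N_ν`. -/
def sharpNorm (α : ℝ) {ν : ℕ} (x : Matrix (Fin (2 ^ ν)) (Fin (2 ^ ν)) ℂ) : ℝ :=
  schatten 1 (x * Amat α ν)

/-- The right predual norm `‖x‖_♭ = ‖A_ν x‖_{C_1}` on `N_ν`. -/
def flatNorm (α : ℝ) {ν : ℕ} (x : Matrix (Fin (2 ^ ν)) (Fin (2 ^ ν)) ℂ) : ℝ :=
  schatten 1 (Amat α ν * x)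

/-- The left predual norm `‖x‖_♯ = ‖x A_1‖_{C_1}` on `M_2(ℂ)`. -/
def sharp2 (α : ℝ) (x : Matrix (Fin 2) (Fin 2) ℂ) : ℝ :=
  schatten 1 (x * A1 α)

/-- The right predual norm `‖x‖_♭ = ‖A_1 x‖_{C_1}` on `M_2(ℂ)`. -/
def flat2 (α : ℝ) (x : Matrix (Fin 2) (Fin 2) ℂ) : ℝ :=
  schatten 1 (A1 α * x)

/-- The left norm `‖x‖_{p,♯} = ‖x A_ν^{1/p}‖_{C_p}` on `N_ν`, `1 ≤ p ≤ ∞`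
(for `p = ∞` it is the operator norm). -/
def lpSharp (α : ℝ) (p : ℝ≥0∞) {ν : ℕ} (x : Matrix (Fin (2 ^ ν)) (Fin (2 ^ ν)) ℂ) : ℝ :=
  if p = ∞ then opNorm x else schatten p.toReal (x * Amatt α (1 / p.toReal) ν)

/-- The right norm `‖x‖_{p,♭} = ‖A_ν^{1/p} x‖_{C_p}` on `N_ν`, `1 ≤ p ≤ ∞`. -/
def lpFlat (α : ℝ) (p : ℝ≥0∞) {ν : ℕ} (x : Matrix (Fin (2 ^ ν)) (Fin (2 ^ ν)) ℂ) : ℝ :=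
  if p = ∞ then opNorm x else schatten p.toReal (Amatt α (1 / p.toReal) ν * x)

/-- The left norm `‖x‖_{p,♯} = ‖x A_1^{1/p}‖_{C_p}` on `M_2(ℂ)`. -/
def lp2Sharp (α : ℝ) (p : ℝ≥0∞) (x : Matrix (Fin 2) (Fin 2) ℂ) : ℝ :=
  if p = ∞ then opNorm x else schatten p.toReal (x * A1t α (1 / p.toReal))

/-- `shellNum r c` is `s(r+1, c+1) - 1`, the zero-based shell enumeration index of the
matrix unit `E_{r c}` (zero-based indices `r`, `c`): `s(r,c) = (c-1)² + r` if `r ≤ c`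
and `s(r,c) = r² - c + 1` if `r > c` (one-based). -/
def shellNum (r c : ℕ) : ℕ :=
  if r ≤ c then c * c + r else r * r + 2 * r - c

/-- `eUnit N m` is the `m`-th matrix unit `e_m` of `M_N(ℂ)` in the shell enumeration:
`e_{s(r,c) - 1} = E_{r c}`. -/
def eUnit (N m : ℕ) : Matrix (Fin N) (Fin N) ℂ :=
  Matrix.of fun r c => if shellNum (r : ℕ) (c : ℕ) = m then 1 else 0

/-- The left Haar system `h^{(ν)}_j` in `N_ν` built from `r_0, r_1, r_2, r_3 ∈ M_2(ℂ)`: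
`h^{(1)}_j = r_j`, and for `j = 4^ν q + k` (`0 ≤ q ≤ 3`, `0 ≤ k < 4^ν`),
`h^{(ν+1)}_j = h^{(ν)}_k ⊗ r_0` if `q = 0` and `h^{(ν+1)}_j = e^{(ν)}_k ⊗ r_q` if `q ≠ 0`. -/
def haar (r : ℕ → Matrix (Fin 2) (Fin 2) ℂ) :
    (ν : ℕ) → ℕ → Matrix (Fin (2 ^ ν)) (Fin (2 ^ ν)) ℂ
  | 0, _ => 1
  | 1, j => r (j % 4)
  | ν + 2, j =>
      if j / 4 ^ (ν + 1) = 0 then kron (haar r (ν + 1) j) (r 0)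
      else kron (eUnit (2 ^ (ν + 1)) (j % 4 ^ (ν + 1))) (r (j / 4 ^ (ν + 1) % 4))


theorem kron_mul' {m n : ℕ} (a c : Matrix (Fin m) (Fin m) ℂ) (b d : Matrix (Fin n) (Fin n) ℂ) :
    kron a b * kron c d = kron (a * c) (b * d) := by
  simp only [kron, Matrix.reindex_apply, Matrix.submatrix_mul_equiv, Matrix.mul_kronecker_mul]

theorem kron_conjTranspose {m n : ℕ} (a : Matrix (Fin m) (Fin m) ℂ)
    (b : Matrix (Fin n) (Fin n) ℂ) : (kron a b)ᴴ = kron aᴴ bᴴ := by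
  simp only [kron, Matrix.reindex_apply, Matrix.conjTranspose_submatrix,
    Matrix.conjTranspose_kronecker]

theorem kron_trace {m n : ℕ} (a : Matrix (Fin m) (Fin m) ℂ)
    (b : Matrix (Fin n) (Fin n) ℂ) : (kron a b).trace = a.trace * b.trace := by
  rw [← Matrix.trace_kronecker]
  simp only [kron, Matrix.reindex_apply, Matrix.trace, Matrix.diag, Matrix.submatrix_apply]
  exact Equiv.sum_comp finProdFinEquiv.symm (fun i => (a ⊗ₖ b) i i)

theorem rho_kron (α : ℝ) (ν : ℕ) (a c : Matrix (Fin (2 ^ ν)) (Fin (2 ^ ν)) ℂ)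
    (b d : Matrix (Fin 2) (Fin 2) ℂ) :
    rho α (ν + 1) ((kron a b)ᴴ * kron c d) = rho α ν (aᴴ * c) * rho1 α (bᴴ * d) := by
  have h : rho α (ν + 1) ((kron a b)ᴴ * kron c d) =
      (((kron a b)ᴴ * kron c d) * kron (Amat α ν) (A1 α)).trace := rfl
  rw [h, kron_conjTranspose, kron_mul', kron_mul', kron_trace]
  rfl

theorem rho_kron_of_eq (α : ℝ) (ν : ℕ) {X Y : Matrix (Fin (2 ^ (ν + 1))) (Fin (2 ^ (ν + 1))) ℂ}
    {a c : Matrix (Fin (2 ^ ν)) (Fin (2 ^ ν)) ℂ}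
    {b d : Matrix (Fin 2) (Fin 2) ℂ} (hX : X = kron a b) (hY : Y = kron c d) :
    rho α (ν + 1) (Xᴴ * Y) = rho α ν (aᴴ * c) * rho1 α (bᴴ * d) := by
  subst hX hY
  exact rho_kron α ν a c b d

theorem Amat_diag (α : ℝ) (h0 : 0 < α) (h1 : α < 1) (ν : ℕ) :
    ∃ w : Fin (2 ^ ν) → ℝ, (∀ i, 0 < w i) ∧ Amat α ν = Matrix.diagonal (fun i => (w i : ℂ)) := by
  induction ν with
  | zero =>
    refine ⟨fun _ => 1, fun _ => one_pos, ?_⟩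
    simp [Amat]
  | succ ν ih =>
    obtain ⟨w, hw, hA⟩ := ih
    refine ⟨fun i => w (finProdFinEquiv.symm i).1 * ![α, 1 - α] (finProdFinEquiv.symm i).2,
      ?_, ?_⟩
    · intro i
      refine mul_pos (hw _) ?_
      generalize (finProdFinEquiv.symm i).2 = t
      fin_cases t
      · exact h0
      · simpa using h1
    · have h : Amat α (ν + 1) = kron (Amat α ν) (A1 α) := rfl
      rw [h, hA, kron, A1, Matrix.diagonal_kronecker_diagonal, Matrix.reindex_apply,
        Matrix.submatrix_diagonal_equiv]
      congr 1
      funext i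
      simp only [Function.comp]
      generalize (finProdFinEquiv.symm i).2 = t
      fin_cases t <;> simp

theorem rho_inner (α : ℝ) (ν : ℕ) (w : Fin (2 ^ ν) → ℝ)
    (hA : Amat α ν = Matrix.diagonal (fun i => (w i : ℂ)))
    (x y : Matrix (Fin (2 ^ ν)) (Fin (2 ^ ν)) ℂ) :
    rho α ν (xᴴ * y) = ∑ c, (∑ i, star (x i c) * y i c) * (w c : ℂ) := by
  simp only [rho, hA, Matrix.trace, Matrix.diag, Matrix.mul_diagonal]
  simp only [Matrix.mul_apply, Matrix.conjTranspose_apply]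

theorem shell_surj (N m : ℕ) (hm : m < N * N) :
    ∃ i c : Fin N, shellNum (i : ℕ) (c : ℕ) = m := by
  have h1 := Nat.sqrt_le m
  have h2 := Nat.sqrt_le_add m
  have h3 : Nat.sqrt m < N := Nat.sqrt_lt.2 hm
  generalize Nat.sqrt m = s at h1 h2 h3
  by_cases h : m - s * s ≤ s
  · refine ⟨⟨m - s * s, by omega⟩, ⟨s, h3⟩, ?_⟩
    simp only [shellNum, if_pos h]
    omega
  · refine ⟨⟨s, h3⟩, ⟨s * s + 2 * s - m, by omega⟩, ?_⟩
    have : ¬ s ≤ s * s + 2 * s - m := by omega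
    simp only [shellNum, if_neg this]
    omega

theorem eUnit_orth (α : ℝ) (h0 : 0 < α) (h1 : α < 1) (ν : ℕ) (j k : ℕ) (hjk : j ≠ k) :
    rho α ν ((eUnit (2 ^ ν) k)ᴴ * eUnit (2 ^ ν) j) = 0 := by
  obtain ⟨w, hw, hA⟩ := Amat_diag α h0 h1 ν
  rw [rho_inner α ν w hA]
  refine Finset.sum_eq_zero fun c _ => ?_
  rw [Finset.sum_eq_zero, zero_mul]
  intro i _
  simp only [eUnit, Matrix.of_apply]
  split_ifs with ha hb
  · exact absurd (hb.symm.trans ha) hjk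
  all_goals simp

theorem eUnit_ne (α : ℝ) (h0 : 0 < α) (h1 : α < 1) (ν : ℕ) (j : ℕ) (hj : j < 4 ^ ν) :
    rho α ν ((eUnit (2 ^ ν) j)ᴴ * eUnit (2 ^ ν) j) ≠ 0 := by
  obtain ⟨w, hw, hA⟩ := Amat_diag α h0 h1 ν
  rw [rho_inner α ν w hA]
  have hN : j < 2 ^ ν * 2 ^ ν := by rwa [← mul_pow]
  obtain ⟨i0, c0, h⟩ := shell_surj _ j hN
  have key : (∑ c, (∑ i, star (eUnit (2 ^ ν) j i c) * eUnit (2 ^ ν) j i c) * (w c : ℂ)) =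
      ((∑ c : Fin (2 ^ ν), (∑ i : Fin (2 ^ ν),
        (if shellNum (i : ℕ) (c : ℕ) = j then (1 : ℝ) else 0)) * w c : ℝ) : ℂ) := by
    push_cast
    refine Finset.sum_congr rfl fun c _ => ?_
    congr 1
    refine Finset.sum_congr rfl fun i _ => ?_
    simp only [eUnit, Matrix.of_apply]
    split_ifs <;> simp
  rw [key]
  refine Complex.ofReal_ne_zero.2 (ne_of_gt ?_)
  have hnn : ∀ c i : Fin (2 ^ ν), (0 : ℝ) ≤ if shellNum (i : ℕ) (c : ℕ) = j then (1 : ℝ) else 0 := by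
    intro c i
    split_ifs <;> norm_num
  refine Finset.sum_pos' (fun c _ => mul_nonneg (Finset.sum_nonneg fun i _ => hnn c i) (hw c).le)
    ⟨c0, Finset.mem_univ _, mul_pos ?_ (hw c0)⟩
  exact Finset.sum_pos' (fun i _ => hnn c0 i) ⟨i0, Finset.mem_univ _, by simp [h]⟩

theorem haar_inner (α : ℝ) (h0 : 0 < α) (h1 : α < 1)
    (r : ℕ → Matrix (Fin 2) (Fin 2) ℂ)
    (hr : ∀ j < 4, ∀ k < 4, rho1 α ((r j)ᴴ * r k) = if j = k then 1 else 0)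
    (ν : ℕ) : ∀ j < 4 ^ (ν + 1), ∀ k < 4 ^ (ν + 1),
      (rho α (ν + 1) ((haar r (ν + 1) k)ᴴ * haar r (ν + 1) j) = 0 ↔ j ≠ k) := by
  induction ν with
  | zero =>
    intro j hj k hk
    have hA : Amat α 1 = A1 α := by
      have h : Amat α 1 = kron (1 : Matrix (Fin 1) (Fin 1) ℂ) (A1 α) := rfl
      rw [h]
      ext i c
      fin_cases i <;> fin_cases c <;> simp [kron, A1, finProdFinEquiv, Fin.divNat, Fin.modNat]
    have h : rho α (0 + 1) ((haar r (0 + 1) k)ᴴ * haar r (0 + 1) j)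
        = rho1 α ((r (k % 4))ᴴ * r (j % 4)) := by
      have h' : rho α (0 + 1) ((haar r (0 + 1) k)ᴴ * haar r (0 + 1) j)
        = (((r (k % 4))ᴴ * r (j % 4)) * Amat α 1).trace := rfl
      rw [h', hA]
      rfl
    rw [h, hr _ (by omega) _ (by omega)]
    have : k % 4 = j % 4 ↔ j = k := by omega
    simp [this]
  | succ ν ih =>
    intro j hj k hk
    have hp : 0 < 4 ^ (ν + 1) := by positivity
    have hq : ∀ j < 4 ^ (ν + 1 + 1), j / 4 ^ (ν + 1) < 4 := by
      intro j hj
      rw [Nat.div_lt_iff_lt_mul hp]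
      rw [pow_succ] at hj
      linarith
    have hqj := hq j hj
    have hqk := hq k hk
    have hd : ∀ j, haar r (ν + 1 + 1) j = if j / 4 ^ (ν + 1) = 0 then kron (haar r (ν + 1) j) (r 0)
      else kron (eUnit (2 ^ (ν + 1)) (j % 4 ^ (ν + 1))) (r (j / 4 ^ (ν + 1) % 4)) := fun _ => rfl
    have hlt : ∀ j, j / 4 ^ (ν + 1) = 0 → j < 4 ^ (ν + 1) := fun j h =>
      (Nat.div_eq_zero_iff_lt hp).1 h
    by_cases hj0 : j / 4 ^ (ν + 1) = 0 <;> by_cases hk0 : k / 4 ^ (ν + 1) = 0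
    · rw [rho_kron_of_eq α (ν + 1) ((hd k).trans (if_pos hk0)) ((hd j).trans (if_pos hj0)),
        hr 0 (by norm_num) 0 (by norm_num), if_pos rfl, mul_one]
      exact ih j (hlt j hj0) k (hlt k hk0)
    · rw [rho_kron_of_eq α (ν + 1) ((hd k).trans (if_neg hk0)) ((hd j).trans (if_pos hj0)),
        Nat.mod_eq_of_lt hqk,
        hr _ hqk _ (by norm_num), if_neg hk0,
        mul_zero]
      refine ⟨fun _ h => ?_, fun _ => rfl⟩
      subst h
      exact hk0 hj0
    · rw [rho_kron_of_eq α (ν + 1) ((hd k).trans (if_pos hk0)) ((hd j).trans (if_neg hj0)),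
        Nat.mod_eq_of_lt hqj,
        hr _ (by norm_num) _ hqj, if_neg (Ne.symm hj0),
        mul_zero]
      refine ⟨fun _ h => ?_, fun _ => rfl⟩
      subst h
      exact hj0 hk0
    · rw [rho_kron_of_eq α (ν + 1) ((hd k).trans (if_neg hk0)) ((hd j).trans (if_neg hj0)),
        hr _ (by omega) _ (by omega),
        Nat.mod_eq_of_lt hqj, Nat.mod_eq_of_lt hqk]
      constructor
      · intro h hjk
        subst hjk
        rw [if_pos rfl, mul_one] at h
        exact eUnit_ne α h0 h1 _ _ (Nat.mod_lt _ hp) h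
      · intro hjk
        by_cases hqq : k / 4 ^ (ν + 1) = j / 4 ^ (ν + 1)
        · rw [eUnit_orth α h0 h1, zero_mul]
          intro hm
          apply hjk
          rw [← Nat.div_add_mod j (4 ^ (ν + 1)), ← Nat.div_add_mod k (4 ^ (ν + 1)), hm, hqq]
        · rw [if_neg hqq, mul_zero]

/-- the left Haar system is a nonzero, `ρ_ν`-orthogonal family and a
linear basis of the `4^ν`-dimensional space `N_ν`. -/
theorem haar_linear_basis
    (α : ℝ) (hα0 : 0 < α) (hα : α ≤ 1 / 2)
    (r : ℕ → Matrix (Fin 2) (Fin 2) ℂ)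
    (hr : ∀ j < 4, ∀ k < 4, rho1 α ((r j)ᴴ * r k) = if j = k then 1 else 0)
    (ν : ℕ) (hν : 1 ≤ ν) :
    (∀ j < 4 ^ ν, haar r ν j ≠ 0) ∧
    (∀ j < 4 ^ ν, ∀ k < 4 ^ ν, j ≠ k → rho α ν ((haar r ν k)ᴴ * haar r ν j) = 0) ∧
    LinearIndependent ℂ (fun j : Fin (4 ^ ν) => haar r ν (j : ℕ)) ∧
    Submodule.span ℂ (Set.range fun j : Fin (4 ^ ν) => haar r ν (j : ℕ)) = ⊤ := by
  obtain ⟨n, rfl⟩ : ∃ n, ν = n + 1 := ⟨ν - 1, by omega⟩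
  have H := haar_inner α hα0 (by linarith) r hr n
  have hli : LinearIndependent ℂ (fun j : Fin (4 ^ (n + 1)) => haar r (n + 1) (j : ℕ)) := by
    rw [Fintype.linearIndependent_iff]
    intro g hg k
    have h2 : rho α (n + 1) ((haar r (n + 1) (k : ℕ))ᴴ *
        ∑ j : Fin (4 ^ (n + 1)), g j • haar r (n + 1) (j : ℕ)) = 0 := by
      rw [hg]
      simp [rho]
    have h3 : rho α (n + 1) ((haar r (n + 1) (k : ℕ))ᴴ *
        ∑ j : Fin (4 ^ (n + 1)), g j • haar r (n + 1) (j : ℕ)) =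
        ∑ j : Fin (4 ^ (n + 1)), g j * rho α (n + 1) ((haar r (n + 1) (k : ℕ))ᴴ *
          haar r (n + 1) (j : ℕ)) := by
      simp only [rho, Matrix.mul_sum, Matrix.sum_mul, Matrix.trace_sum, Matrix.mul_smul,
        Matrix.smul_mul, Matrix.trace_smul, smul_eq_mul]
    rw [h3, Finset.sum_eq_single k] at h2
    · refine (mul_eq_zero.1 h2).resolve_right fun h => ?_
      exact (H k k.2 k k.2).1 h rfl
    · intro j _ hjk
      rw [(H j j.2 k k.2).2 (fun h => hjk (Fin.ext h)), mul_zero]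
    · intro h
      exact absurd (Finset.mem_univ k) h
  refine ⟨?_, fun j hj k hk hjk => (H j hj k hk).2 hjk, hli, ?_⟩
  · intro j hj h
    refine (H j hj j hj).1 ?_ rfl
    rw [h]
    simp [rho]
  · refine hli.span_eq_top_of_card_eq_finrank' ?_
    rw [Module.finrank_matrix]
    simp [← mul_pow]

end
end

section
/- Set λ = α/(1−α) and define r_0 = 1_2, r_1 = diag(λ^{−1/2}, −λ^{1/2}), r_2 = [[0,1],[1,0]], r_3 = [[0, −λ^{1/2}],[λ^{−1/2}, 0]]. Then ρ_1(r_j* r_k) = δ_{jk} for 0 ≤ j, k ≤ 3 and ‖r_0‖ = 1, and consequently there is a constant C = C(α) such that for every ν ≥ 1, every 0 ≤ m < 4^ν, and all complex scalars, ‖Σ_{j=0}^{m} α_j h^{(ν)}_j‖_♯ ≤ C·‖Σ_{j=0}^{4^ν−1} α_j h^{(ν)}_j‖_♯: the left Haar systems built from this Rademacher system are bases of (N_ν, ‖·‖_♯) with uniformly bounded basis constants. (This is the finite-level content of the statement that this Haar system is a Schauder basis of the predual of the hyperfinite factor of type III_λ for 0 < α < 1/2, and of type II_1 for α = 1/2.)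 -/
open Finset
open scoped ENNReal ComplexOrder Kronecker Matrix

noncomputable section

/-- The non-commutative Rademacher system (λ = α/(1-α)):
`r_0 = 1`, `r_1 = diag(λ^{-1/2}, -λ^{1/2})`, `r_2 = [[0,1],[1,0]]`,
`r_3 = [[0,-λ^{1/2}],[λ^{-1/2},0]]`. -/
def rad (α : ℝ) : ℕ → Matrix (Fin 2) (Fin 2) ℂ := fun j =>
  if j = 0 then 1
  else if j = 1 then
    !![(((Real.sqrt (α / (1 - α)))⁻¹ : ℝ) : ℂ), 0; 0, -((Real.sqrt (α / (1 - α)) : ℝ) : ℂ)]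
  else if j = 2 then !![0, 1; 1, 0]
  else !![0, -((Real.sqrt (α / (1 - α)) : ℝ) : ℂ); (((Real.sqrt (α / (1 - α)))⁻¹ : ℝ) : ℂ), 0]

/-- Euclidean norm of a plain vector. -/
def nrm {n : Type} [Fintype n] (v : n → ℂ) : ℝ := ‖(WithLp.toLp 2 v : EuclideanSpace ℂ n)‖

theorem nrm_eq {n : Type} [Fintype n] (v : n → ℂ) : nrm v = √(∑ i, ‖v i‖ ^ 2) := by
  simp [nrm, EuclideanSpace.norm_eq]

/-- The nuclear norm of `x` is at most `c`, witnessed by a rank one decomposition. -/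
def NucLe {n : Type} [Fintype n] (x : Matrix n n ℂ) (c : ℝ) : Prop :=
  ∃ (J : Type) (_ : Fintype J) (u v : J → n → ℂ),
    (∀ a b, x a b = ∑ j, u j a * v j b) ∧ ∑ j, nrm (u j) * nrm (v j) ≤ c

theorem nrm_nonneg {n : Type} [Fintype n] (v : n → ℂ) : 0 ≤ nrm v := norm_nonneg _

theorem nrm_le {n : Type} [Fintype n] (v w : n → ℂ) (h : ∀ i, ‖v i‖ ≤ ‖w i‖) :
    nrm v ≤ nrm w := by
  rw [nrm_eq, nrm_eq]
  apply Real.sqrt_le_sqrt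
  gcongr with i
  exact h i

theorem gram {N : ℕ} (x : Matrix (Fin N) (Fin N) ℂ) (i j : Fin N) :
    inner ℂ (WithLp.toLp 2 (x *ᵥ ((Matrix.posSemidef_conjTranspose_mul_self x).isHermitian.eigenvectorBasis i).ofLp) : EuclideanSpace ℂ (Fin N))
      (WithLp.toLp 2 (x *ᵥ ((Matrix.posSemidef_conjTranspose_mul_self x).isHermitian.eigenvectorBasis j).ofLp)) =
    if i = j then (((Matrix.posSemidef_conjTranspose_mul_self x).isHermitian.eigenvalues j : ℝ) : ℂ) else 0 := by
  set hH := (Matrix.posSemidef_conjTranspose_mul_self x).isHermitian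
  have h1 := hH.mulVec_eigenvectorBasis j
  have h2 : inner ℂ (hH.eigenvectorBasis i) (hH.eigenvectorBasis j) = if i = j then (1:ℂ) else 0 :=
    orthonormal_iff_ite.mp hH.eigenvectorBasis.orthonormal i j
  rw [EuclideanSpace.inner_eq_star_dotProduct] at h2 ⊢
  simp only
  rw [Matrix.star_mulVec, dotProduct_comm, ← Matrix.dotProduct_mulVec, Matrix.mulVec_mulVec, h1]
  rw [dotProduct_comm] at h2
  rw [dotProduct_smul, h2]
  split_ifs <;> simp

theorem schatten_one {N : ℕ} (x : Matrix (Fin N) (Fin N) ℂ) : schatten 1 x =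
    ∑ i, √((Matrix.posSemidef_conjTranspose_mul_self x).isHermitian.eigenvalues i) := by
  simp [schatten, Real.sqrt_eq_rpow]

theorem nucLe_schatten {N : ℕ} (x : Matrix (Fin N) (Fin N) ℂ) : NucLe x (schatten 1 x) := by
  set hH := (Matrix.posSemidef_conjTranspose_mul_self x).isHermitian with hHd
  refine ⟨Fin N, inferInstance, fun i => x *ᵥ (hH.eigenvectorBasis i).ofLp,
    fun i => star (hH.eigenvectorBasis i).ofLp, ?_, ?_⟩
  · intro a b
    have hu : (hH.eigenvectorUnitary : Matrix (Fin N) (Fin N) ℂ) *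
        star (hH.eigenvectorUnitary : Matrix (Fin N) (Fin N) ℂ) = 1 :=
      Unitary.coe_mul_star_self _
    have : x = (x * (hH.eigenvectorUnitary : Matrix (Fin N) (Fin N) ℂ)) *
        star (hH.eigenvectorUnitary : Matrix (Fin N) (Fin N) ℂ) := by
      rw [Matrix.mul_assoc, hu, Matrix.mul_one]
    conv_lhs => rw [this]
    rw [Matrix.mul_apply]
    rfl
  · rw [schatten_one]
    apply Finset.sum_le_sum
    intro i _
    have h1 : nrm (star (hH.eigenvectorBasis i).ofLp) = 1 := by
      have : ‖hH.eigenvectorBasis i‖ = 1 := hH.eigenvectorBasis.orthonormal.1 i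
      rw [EuclideanSpace.norm_eq] at this
      rw [nrm_eq]; simpa using this
    rw [h1, mul_one]
    have h2 := gram x i i
    rw [inner_self_eq_norm_sq_to_K] at h2
    simp only [if_true] at h2
    apply Real.le_sqrt_of_sq_le
    apply le_of_eq
    exact Complex.ofReal_injective (by rw [Complex.ofReal_pow]; exact h2)

theorem schatten_le {N : ℕ} (x : Matrix (Fin N) (Fin N) ℂ) (c : ℝ) (h : NucLe x c) :
    schatten 1 x ≤ c := by
  obtain ⟨J, _, u, v, hx, hc⟩ := h
  refine le_trans ?_ hc
  rw [schatten_one]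
  set hH := (Matrix.posSemidef_conjTranspose_mul_self x).isHermitian with hHd
  have hnn : ∀ i, 0 ≤ hH.eigenvalues i :=
    (Matrix.posSemidef_conjTranspose_mul_self x).eigenvalues_nonneg
  let g : Fin N → EuclideanSpace ℂ (Fin N) := fun i =>
    WithLp.toLp 2 (x *ᵥ (hH.eigenvectorBasis i).ofLp)
  have hg : ∀ i j, inner ℂ (g i) (g j) = if i = j then ((hH.eigenvalues j : ℝ) : ℂ) else 0 := gram x
  let S := {i : Fin N // hH.eigenvalues i ≠ 0}
  let f : S → EuclideanSpace ℂ (Fin N) := fun i => (((√(hH.eigenvalues i))⁻¹ : ℝ) : ℂ) • g i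
  have hf : Orthonormal ℂ f := by
    rw [orthonormal_iff_ite]
    intro i j
    simp only [f, inner_smul_left, inner_smul_right, hg]
    by_cases hij : i = j
    · subst hij
      simp only [if_true, Complex.conj_ofReal]
      have : √(hH.eigenvalues i) ≠ 0 := by
        rw [Real.sqrt_ne_zero (hnn _)]; exact i.2
      have h3 := Real.mul_self_sqrt (hnn i)
      norm_cast
      conv_lhs => rw [← h3]
      field_simp
      rw [Real.sqrt_sq (Real.sqrt_nonneg _)]
    · have : (i : Fin N) ≠ j := fun h => hij (Subtype.ext h)
      simp [hij, this]
  have hfe : ∀ i : S, ((√(hH.eigenvalues i) : ℝ) : ℂ) = inner ℂ (f i) (g i) := by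
    intro i
    have : √(hH.eigenvalues i) ≠ 0 := by
      rw [Real.sqrt_ne_zero (hnn _)]; exact i.2
    have h3 := Real.mul_self_sqrt (hnn i)
    simp only [f, inner_smul_left, hg, if_true, Complex.conj_ofReal]
    norm_cast
    rw [eq_inv_mul_iff_mul_eq₀ this, h3]
  have hgu : ∀ i, g i = ∑ j, inner ℂ (WithLp.toLp 2 (star (v j)) : EuclideanSpace ℂ (Fin N)) (hH.eigenvectorBasis i) • (WithLp.toLp 2 (u j) : EuclideanSpace ℂ (Fin N)) := by
    intro i
    ext a
    simp only [g, Matrix.mulVec, dotProduct, hx, WithLp.ofLp_sum, WithLp.ofLp_smul, Finset.sum_apply, Pi.smul_apply, smul_eq_mul,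
      EuclideanSpace.inner_eq_star_dotProduct, star_star, Finset.sum_mul]
    rw [Finset.sum_comm]
    refine Finset.sum_congr rfl fun j _ => Finset.sum_congr rfl fun b _ => ?_
    ring
  have hsum : ∑ i, √(hH.eigenvalues i) = ∑ i : S, √(hH.eigenvalues i) := by
    rw [← Finset.sum_filter_of_ne (p := fun i => hH.eigenvalues i ≠ 0)]
    · exact Finset.sum_subtype _ (by simp) _
    · intro i _ h h0
      simp [h0] at h
  rw [hsum]
  have key : ((∑ i : S, √(hH.eigenvalues i) : ℝ) : ℂ) =
      ∑ j, ∑ i : S, inner ℂ (WithLp.toLp 2 (star (v j)) : EuclideanSpace ℂ (Fin N)) (hH.eigenvectorBasis i) * inner ℂ (f i) (WithLp.toLp 2 (u j) : EuclideanSpace ℂ (Fin N)) := by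
    push_cast
    rw [Finset.sum_comm]
    refine Finset.sum_congr rfl fun i _ => ?_
    rw [hfe, hgu, inner_sum]
    refine Finset.sum_congr rfl fun j _ => ?_
    rw [inner_smul_right]
  have hnn2 : 0 ≤ ∑ i : S, √(hH.eigenvalues i) := Finset.sum_nonneg fun i _ => Real.sqrt_nonneg _
  have : ∑ i : S, √(hH.eigenvalues i) = ‖((∑ i : S, √(hH.eigenvalues i) : ℝ) : ℂ)‖ := by
    rw [Complex.norm_real, Real.norm_of_nonneg hnn2]
  rw [this, key]
  refine (norm_sum_le _ _).trans (Finset.sum_le_sum fun j _ => ?_)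
  refine (norm_sum_le _ _).trans ?_
  simp only [norm_mul]
  refine (Real.sum_mul_le_sqrt_mul_sqrt _ _ _).trans ?_
  have b1 := hf.sum_inner_products_le (WithLp.toLp 2 (u j) : EuclideanSpace ℂ (Fin N)) (s := Finset.univ)
  have ho : Orthonormal ℂ (fun i : S => hH.eigenvectorBasis i) :=
    hH.eigenvectorBasis.orthonormal.comp _ Subtype.val_injective
  have b2 := ho.sum_inner_products_le (WithLp.toLp 2 (star (v j)) : EuclideanSpace ℂ (Fin N)) (s := Finset.univ)
  have e2 : ‖(WithLp.toLp 2 (star (v j)) : EuclideanSpace ℂ (Fin N))‖ = nrm (v j) := by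
    rw [nrm_eq, EuclideanSpace.norm_eq]; simp
  rw [e2] at b2
  rw [mul_comm]
  apply mul_le_mul _ _ (Real.sqrt_nonneg _) (nrm_nonneg _)
  · exact Real.sqrt_le_iff.mpr ⟨nrm_nonneg _, b1⟩
  · refine Real.sqrt_le_iff.mpr ⟨nrm_nonneg _, le_trans (le_of_eq ?_) b2⟩
    refine Finset.sum_congr rfl fun i _ => ?_
    rw [norm_inner_symm]

section
variable {n k : Type} [Fintype n] [Fintype k]

theorem NucLe.mono {x : Matrix n n ℂ} {c d : ℝ} (h : NucLe x c) (hcd : c ≤ d) : NucLe x d := by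
  obtain ⟨J, i, u, v, hx, hc⟩ := h
  exact ⟨J, i, u, v, hx, hc.trans hcd⟩

theorem NucLe.nonneg {x : Matrix n n ℂ} {c : ℝ} (h : NucLe x c) : 0 ≤ c := by
  obtain ⟨J, i, u, v, hx, hc⟩ := h
  exact le_trans (Finset.sum_nonneg fun j _ => mul_nonneg (nrm_nonneg _) (nrm_nonneg _)) hc

theorem NucLe.add {x y : Matrix n n ℂ} {c d : ℝ} (h : NucLe x c) (h' : NucLe y d) :
    NucLe (x + y) (c + d) := by
  obtain ⟨J, i, u, v, hx, hc⟩ := h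
  obtain ⟨J', i', u', v', hx', hc'⟩ := h'
  refine ⟨J ⊕ J', inferInstance, Sum.elim u u', Sum.elim v v', ?_, ?_⟩
  · intro a b; simp [hx, hx']
  · simp only [Fintype.sum_sum_type, Sum.elim_inl, Sum.elim_inr]; linarith

theorem NucLe.zero : NucLe (0 : Matrix n n ℂ) 0 := by
  refine ⟨Empty, inferInstance, fun j => j.elim, fun j => j.elim, ?_, ?_⟩ <;> simp

theorem NucLe.sum {ι : Type} (s : Finset ι) (x : ι → Matrix n n ℂ) (c : ι → ℝ)
    (h : ∀ i ∈ s, NucLe (x i) (c i)) : NucLe (∑ i ∈ s, x i) (∑ i ∈ s, c i) := by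
  classical
  induction s using Finset.induction_on with
  | empty => simpa using NucLe.zero
  | insert a s ha ih =>
    rw [Finset.sum_insert ha, Finset.sum_insert ha]
    exact (h a (by simp)).add (ih fun i hi => h i (by simp [hi]))

theorem nrm_smul (z : ℂ) (v : n → ℂ) : nrm (z • v) = ‖z‖ * nrm v := by
  unfold nrm
  rw [← norm_smul]; rfl

theorem NucLe.smul {x : Matrix n n ℂ} {c : ℝ} (h : NucLe x c) (z : ℂ) :
    NucLe (z • x) (‖z‖ * c) := by
  obtain ⟨J, i, u, v, hx, hc⟩ := h
  refine ⟨J, i, fun j => z • u j, v, ?_, ?_⟩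
  · intro a b; simp [hx, Finset.mul_sum, mul_assoc]
  · simp only [nrm_smul, mul_assoc, ← Finset.mul_sum]
    gcongr

theorem NucLe.mask {x : Matrix n n ℂ} {c : ℝ} (h : NucLe x c) (p q : n → Prop)
    [DecidablePred p] [DecidablePred q] :
    NucLe (Matrix.of fun a b => if p a ∧ q b then x a b else 0) c := by
  obtain ⟨J, i, u, v, hx, hc⟩ := h
  refine ⟨J, i, fun j a => if p a then u j a else 0, fun j b => if q b then v j b else 0, ?_,
    le_trans ?_ hc⟩
  · intro a b
    by_cases h1 : p a <;> by_cases h2 : q b <;> simp [h1, h2, hx]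
  · gcongr with j
    · exact nrm_nonneg _
    · exact nrm_nonneg _
    · apply nrm_le; intro a; dsimp; split_ifs <;> simp
    · apply nrm_le; intro a; dsimp; split_ifs <;> simp

theorem nrm_comp (e : k ≃ n) (v : n → ℂ) : nrm (v ∘ e) = nrm v := by
  rw [nrm_eq, nrm_eq]
  congr 1
  exact Equiv.sum_comp e (fun i => ‖v i‖ ^ 2)

theorem NucLe.submatrix {x : Matrix n n ℂ} {c : ℝ} (h : NucLe x c) (e : k ≃ n) :
    NucLe (x.submatrix e e) c := by
  obtain ⟨J, i, u, v, hx, hc⟩ := h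
  refine ⟨J, i, fun j => u j ∘ e, fun j => v j ∘ e, ?_, ?_⟩
  · intro a b; simp [hx]
  · simpa only [nrm_comp] using hc

theorem nrm_prod (u : n → ℂ) (v : k → ℂ) :
    nrm (fun p : n × k => u p.1 * v p.2) = nrm u * nrm v := by
  rw [nrm_eq, nrm_eq, nrm_eq, ← Real.sqrt_mul (by positivity), Fintype.sum_prod_type,
    Finset.sum_mul_sum]
  simp [mul_pow]

theorem NucLe.kronecker {x : Matrix n n ℂ} {y : Matrix k k ℂ} {c d : ℝ} (h : NucLe x c)
    (h' : NucLe y d) : NucLe (x ⊗ₖ y) (c * d) := by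
  have hc0 := h.nonneg
  obtain ⟨J, i, u, v, hx, hc⟩ := h
  obtain ⟨J', i', u', v', hx', hc'⟩ := h'
  refine ⟨J × J', inferInstance, fun j p => u j.1 p.1 * u' j.2 p.2,
    fun j p => v j.1 p.1 * v' j.2 p.2, ?_, ?_⟩
  · intro a b
    simp only [Matrix.kroneckerMap_apply, hx, hx', Fintype.sum_prod_type, Finset.sum_mul_sum]
    refine Finset.sum_congr rfl fun j _ => Finset.sum_congr rfl fun j' _ => ?_
    ring
  · simp only [nrm_prod]
    calc _ = (∑ j, nrm (u j) * nrm (v j)) * (∑ j, nrm (u' j) * nrm (v' j)) := by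
          rw [Fintype.sum_prod_type, Finset.sum_mul_sum]
          refine Finset.sum_congr rfl fun j _ => Finset.sum_congr rfl fun j' _ => ?_
          ring
      _ ≤ c * d := by
          gcongr
          exact Finset.sum_nonneg fun j _ => mul_nonneg (nrm_nonneg _) (nrm_nonneg _)

theorem nrm_slice (u : n × k → ℂ) (t : k) : nrm (fun a => u (a, t)) ≤ nrm u := by
  rw [nrm_eq, nrm_eq, Fintype.sum_prod_type]
  apply Real.sqrt_le_sqrt
  gcongr with a
  exact Finset.single_le_sum (f := fun t => ‖u (a, t)‖ ^ 2) (fun _ _ => by positivity)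
    (Finset.mem_univ t)

theorem NucLe.slice {x : Matrix (n × k) (n × k) ℂ} {c : ℝ} (h : NucLe x c) (t s : k) :
    NucLe (Matrix.of fun a b => x (a, t) (b, s)) c := by
  obtain ⟨J, i, u, v, hx, hc⟩ := h
  refine ⟨J, i, fun j a => u j (a, t), fun j a => v j (a, s), ?_, le_trans ?_ hc⟩
  · intro a b; simp [hx]
  · gcongr with j
    · exact nrm_nonneg _
    · exact nrm_nonneg _
    · exact nrm_slice _ _
    · exact nrm_slice _ _

theorem NucLe.ptrace {x : Matrix (n × k) (n × k) ℂ} {c : ℝ} (h : NucLe x c) :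
    NucLe (Matrix.of fun a b => ∑ t, x (a, t) (b, t)) c := by
  obtain ⟨J, i, u, v, hx, hc⟩ := h
  refine ⟨J × k, inferInstance, fun j a => u j.1 (a, j.2), fun j a => v j.1 (a, j.2), ?_,
    le_trans ?_ hc⟩
  · intro a b
    simp only [Matrix.of_apply, hx, Fintype.sum_prod_type]
    rw [Finset.sum_comm]
  · rw [Fintype.sum_prod_type]
    gcongr with j
    refine (Real.sum_mul_le_sqrt_mul_sqrt _ _ _).trans (le_of_eq ?_)
    have aux : ∀ w : n × k → ℂ, √(∑ t, nrm (fun a => w (a, t)) ^ 2) = nrm w := by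
      intro w
      rw [nrm_eq, Fintype.sum_prod_type, Finset.sum_comm]
      congr 1
      refine Finset.sum_congr rfl fun t _ => ?_
      rw [nrm_eq, Real.sq_sqrt (by positivity)]
    exact congrArg₂ (· * ·) (aux (u j)) (aux (v j))

end

theorem nucLe_iff {N : ℕ} (x : Matrix (Fin N) (Fin N) ℂ) (c : ℝ) :
    NucLe x c ↔ schatten 1 x ≤ c :=
  ⟨schatten_le x c, fun h => (nucLe_schatten x).mono h⟩

theorem shell_split (r c n p : ℕ) (h1 : n * n ≤ p) (h2 : p < (n + 1) * (n + 1)) (z : ℂ) :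
    (if shellNum r c < p then z else 0) =
      (if r < n ∧ c < n then z else 0) + (if (r ≤ n ∧ n * n + r < p) ∧ c = n then z else 0) +
        (if r = n ∧ (c < n ∧ n * n + 2 * n - c < p) then z else 0) := by
  unfold shellNum
  rcases le_or_gt r c with h | h
  · rw [if_pos h]
    rcases lt_trichotomy c n with hc | hc | hc
    · have : c * c + r < p := by nlinarith
      have hr : r < n := by omega
      simp [this, hr, hc, hc.ne, hr.ne]
    · subst hc
      simp [h]
    · have : ¬ (c * c + r < p) := by nlinarith
      simp [this, hc.ne', not_lt.mpr hc.le]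
  · rw [if_neg (not_le.mpr h)]
    rcases lt_trichotomy r n with hc | hc | hc
    · have : r * r + 2 * r - c < p := by
        have : r * r + 2 * r < p := by nlinarith
        omega
      have hr : c < n := by omega
      simp [this, hr, hc, hc.ne, hr.ne]
    · subst hc
      simp [h, h.ne]
    · have : ¬ (r * r + 2 * r - c < p) := by
        have : p ≤ r * r := by nlinarith
        omega
      simp [this, hc.ne', not_lt.mpr hc.le, not_le.mpr hc]

theorem NucLe.shell {N : ℕ} {x : Matrix (Fin N) (Fin N) ℂ} {c : ℝ} (h : NucLe x c) (p : ℕ) :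
    NucLe (Matrix.of fun r s : Fin N => if shellNum r s < p then x r s else 0) (3 * c) := by
  have a1 := h.mask (fun r => (r : ℕ) < Nat.sqrt p) (fun s => (s : ℕ) < Nat.sqrt p)
  have a2 := h.mask (fun r => (r : ℕ) ≤ Nat.sqrt p ∧ Nat.sqrt p * Nat.sqrt p + r < p)
    (fun s => (s : ℕ) = Nat.sqrt p)
  have a3 := h.mask (fun r => (r : ℕ) = Nat.sqrt p)
    (fun s => (s : ℕ) < Nat.sqrt p ∧ Nat.sqrt p * Nat.sqrt p + 2 * Nat.sqrt p - s < p)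
  have := ((a1.add a2).add a3).mono (show c + c + c ≤ 3 * c by linarith)
  convert this using 1
  ext r s
  simp only [Matrix.of_apply, Matrix.add_apply]
  exact shell_split r s _ p (Nat.sqrt_le p) (Nat.lt_succ_sqrt p) _

theorem shell_lt {N r c : ℕ} (hr : r < N) (hc : c < N) : shellNum r c < N * N := by
  unfold shellNum
  split_ifs with h
  · nlinarith
  · have : r * r + 2 * r < N * N := by nlinarith
    omega

theorem sum_eUnit (N : ℕ) (b : ℕ → ℂ) :
    ∑ k ∈ Finset.range (N * N), b k • eUnit N k = Matrix.of fun r c : Fin N => b (shellNum r c) := by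
  ext r c
  have := shell_lt r.2 c.2
  simp [Matrix.sum_apply, eUnit, this]

theorem kron_mul {m n : ℕ} (x x' : Matrix (Fin m) (Fin m) ℂ) (y y' : Matrix (Fin n) (Fin n) ℂ) :
    kron x y * kron x' y' = kron (x * x') (y * y') := by
  simp only [kron, Matrix.reindex_apply, Matrix.submatrix_mul_equiv, Matrix.mul_kronecker_mul]

theorem NucLe.kron {m n : ℕ} {x : Matrix (Fin m) (Fin m) ℂ} {y : Matrix (Fin n) (Fin n) ℂ}
    {c d : ℝ} (h : NucLe x c) (h' : NucLe y d) : NucLe (kron x y) (c * d) :=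
  (h.kronecker h').submatrix _

theorem kron_add {m n : ℕ} (x x' : Matrix (Fin m) (Fin m) ℂ) (y : Matrix (Fin n) (Fin n) ℂ) :
    kron (x + x') y = kron x y + kron x' y := by
  ext; simp [_root_.kron, add_mul]

theorem kron_smul {m n : ℕ} (z : ℂ) (x : Matrix (Fin m) (Fin m) ℂ) (y : Matrix (Fin n) (Fin n) ℂ) :
    kron (z • x) y = z • kron x y := by
  ext; simp [_root_.kron, mul_assoc]

theorem kron_zero {m n : ℕ} (y : Matrix (Fin n) (Fin n) ℂ) :
    kron (0 : Matrix (Fin m) (Fin m) ℂ) y = 0 := by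
  ext; simp [_root_.kron]

theorem kron_sum {m n : ℕ} (s : Finset ℕ) (b : ℕ → ℂ) (x : ℕ → Matrix (Fin m) (Fin m) ℂ)
    (y : Matrix (Fin n) (Fin n) ℂ) :
    kron (∑ j ∈ s, b j • x j) y = ∑ j ∈ s, b j • kron (x j) y := by
  classical
  induction s using Finset.induction_on with
  | empty => simp [kron_zero]
  | insert a s ha ih => rw [Finset.sum_insert ha, Finset.sum_insert ha, kron_add, kron_smul, ih]

theorem Amat_diag_s14 (α : ℝ) (ν : ℕ) : ∃ d, Amat α ν = Matrix.diagonal d := by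
  induction ν with
  | zero => exact ⟨1, (Matrix.diagonal_one).symm⟩
  | succ ν ih =>
    obtain ⟨d, hd⟩ := ih
    show ∃ d, kron (Amat α ν) (A1 α) = Matrix.diagonal d
    rw [hd, A1, kron, Matrix.diagonal_kronecker_diagonal, Matrix.reindex_apply,
      Matrix.submatrix_diagonal_equiv]
    exact ⟨_, rfl⟩

theorem rad_orth (α : ℝ) (hα0 : 0 < α) (hα : α ≤ 1 / 2) :
    ∀ j < 4, ∀ k < 4, rho1 α ((rad α j)ᴴ * rad α k) = if j = k then 1 else 0 := by
  have hs : 0 < √(α / (1 - α)) := Real.sqrt_pos.mpr (div_pos hα0 (by linarith))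
  have h2 : √(α / (1 - α)) * √(α / (1 - α)) * (1 - α) = α := by
    rw [Real.mul_self_sqrt (div_pos hα0 (by linarith)).le]
    field_simp [show 1 - α ≠ 0 by linarith]
  unfold rad
  set s := √(α / (1 - α)) with hsd
  clear_value s
  have hs' : (s : ℂ) ≠ 0 := by exact_mod_cast hs.ne'
  have h2' : (s : ℂ) * s * (1 - α) = α := by exact_mod_cast h2
  intro j hj k hk
  interval_cases j <;> interval_cases k <;>
    simp [rho1, A1, Matrix.trace_fin_two, Matrix.mul_apply, Fin.sum_univ_two,
      Matrix.conjTranspose_apply, Matrix.vecMul_diagonal] <;> try field_simp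
  all_goals first
    | ring1
    | linear_combination -h2'
    | linear_combination h2'
    | linear_combination (s ^ 2 - 1 : ℂ) * h2'
    | linear_combination (1 - s ^ 2 : ℂ) * h2'

theorem opNorm_rad_zero (α : ℝ) : opNorm (rad α 0) = 1 := by
  simp [opNorm, rad]

theorem haar_succ (r : ℕ → Matrix (Fin 2) (Fin 2) ℂ) (ν j : ℕ) (hj : j < 4 ^ (ν + 1)) :
    haar r (ν + 1) j = if j / 4 ^ ν = 0 then kron (haar r ν j) (r 0)
      else kron (eUnit (2 ^ ν) (j % 4 ^ ν)) (r (j / 4 ^ ν % 4)) := by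
  cases ν with
  | succ ν => rfl
  | zero =>
    have e1 : ∀ y : Matrix (Fin 2) (Fin 2) ℂ,
        (kron (1 : Matrix (Fin (2 ^ 0)) (Fin (2 ^ 0)) ℂ) y : Matrix (Fin (2 ^ 0 * 2)) _ ℂ) = y := by
      intro y
      ext a b
      change Fin 2 at a b
      have h1 : ∀ a : Fin 2, (finProdFinEquiv.symm (a : Fin (2 ^ 0 * 2)) : Fin (2 ^ 0) × Fin 2) =
          (0, a) := by decide
      show (1 : Matrix (Fin (2 ^ 0)) (Fin (2 ^ 0)) ℂ)
        (finProdFinEquiv.symm (a : Fin (2 ^ 0 * 2)) : Fin (2 ^ 0) × Fin 2).1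
        (finProdFinEquiv.symm (b : Fin (2 ^ 0 * 2)) : Fin (2 ^ 0) × Fin 2).1 *
        y (finProdFinEquiv.symm (a : Fin (2 ^ 0 * 2)) : Fin (2 ^ 0) × Fin 2).2
          (finProdFinEquiv.symm (b : Fin (2 ^ 0 * 2)) : Fin (2 ^ 0) × Fin 2).2 = y a b
      rw [h1 a, h1 b]
      simp
    have e2 : eUnit (2 ^ 0) 0 = 1 := by
      ext a b
      change Fin 1 at a b
      fin_cases a; fin_cases b
      simp [eUnit, shellNum]
    simp only [pow_zero, Nat.div_one, Nat.mod_one]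
    rw [e2]
    simp only [haar]
    rw [e1, e1]
    split_ifs with h
    · subst h; rfl
    · rfl

/-- The full Haar sum. -/
def full (r : ℕ → Matrix (Fin 2) (Fin 2) ℂ) (a : ℕ → ℂ) (ν : ℕ) :
    Matrix (Fin (2 ^ ν)) (Fin (2 ^ ν)) ℂ := ∑ j ∈ Finset.range (4 ^ ν), a j • haar r ν j

/-- The matrix with entries `b` in shell order. -/
def shellMat (N : ℕ) (b : ℕ → ℂ) : Matrix (Fin N) (Fin N) ℂ :=
  Matrix.of fun r c : Fin N => b (shellNum r c)

/-- Components of the Haar sum. -/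
def comp (r : ℕ → Matrix (Fin 2) (Fin 2) ℂ) (a : ℕ → ℂ) (ν q : ℕ) :
    Matrix (Fin (2 ^ ν)) (Fin (2 ^ ν)) ℂ :=
  if q = 0 then full r a ν else shellMat (2 ^ ν) (fun k => a (4 ^ ν * q + k))

theorem full_succ (r : ℕ → Matrix (Fin 2) (Fin 2) ℂ) (a : ℕ → ℂ) (ν : ℕ) :
    full r a (ν + 1) = ∑ q ∈ Finset.range 4, kron (comp r a ν q) (r q) := by
  have hN : 0 < 4 ^ ν := by positivity
  have h44 : 4 ^ ν = 2 ^ ν * 2 ^ ν := by rw [← mul_pow]; norm_num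
  have hq : ∀ q, 1 ≤ q → q < 4 →
      ∑ k ∈ Finset.range (4 ^ ν), a (4 ^ ν * q + k) • haar r (ν + 1) (4 ^ ν * q + k) =
      kron (comp r a ν q) (r q) := by
    intro q h1 h4
    rw [comp, if_neg (by omega), shellMat, ← sum_eUnit (2 ^ ν) (fun k => a (4 ^ ν * q + k)),
      kron_sum, ← h44]
    refine Finset.sum_congr rfl fun k hk => ?_
    have hk := Finset.mem_range.mp hk
    have hlt : 4 ^ ν * q + k < 4 ^ (ν + 1) := by rw [pow_succ]; nlinarith
    have hdiv : (4 ^ ν * q + k) / 4 ^ ν = q := by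
      rw [Nat.mul_add_div hN, Nat.div_eq_of_lt hk, add_zero]
    have hmod : (4 ^ ν * q + k) % 4 ^ ν = k := by
      rw [Nat.mul_add_mod, Nat.mod_eq_of_lt hk]
    rw [haar_succ r ν _ hlt, hdiv, hmod, if_neg (by omega), Nat.mod_eq_of_lt h4]
    rfl
  have h0 : ∑ k ∈ Finset.range (4 ^ ν), a k • haar r (ν + 1) k = kron (comp r a ν 0) (r 0) := by
    rw [comp, if_pos rfl, full, kron_sum]
    refine Finset.sum_congr rfl fun k hk => ?_
    have hk := Finset.mem_range.mp hk
    have hlt : k < 4 ^ (ν + 1) := by rw [pow_succ]; omega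
    rw [haar_succ r ν _ hlt, Nat.div_eq_of_lt hk, if_pos rfl]
    rfl
  have e : 4 ^ (ν + 1) = 4 ^ ν * 1 + 4 ^ ν + 4 ^ ν + 4 ^ ν := by ring
  rw [full, e, Finset.sum_range_add, Finset.sum_range_add, Finset.sum_range_add]
  have e2 : 4 ^ ν * 1 + 4 ^ ν = 4 ^ ν * 2 := by ring
  have e3 : 4 ^ ν * 2 + 4 ^ ν = 4 ^ ν * 3 := by ring
  rw [e2, e3, hq 1 (by norm_num) (by norm_num), hq 2 (by norm_num) (by norm_num),
    hq 3 (by norm_num) (by norm_num), mul_one, h0]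
  simp only [Finset.sum_range_succ, Finset.sum_range_zero, zero_add]
  rfl

theorem extract_kron {N : ℕ} (Z : Matrix (Fin N) (Fin N) ℂ) (w v : Matrix (Fin 2) (Fin 2) ℂ) (α : ℝ)
    (a b : Fin N) :
    ∑ t, ∑ s, star (w t s) *
      kron Z (v * A1 α) (finProdFinEquiv (a, t)) (finProdFinEquiv (b, s)) =
    Z a b * rho1 α (wᴴ * v) := by
  simp [kron, rho1, Matrix.trace_fin_two, Matrix.mul_apply, A1,
    Fin.sum_univ_two, -finProdFinEquiv_apply_val]
  ring

theorem extract (α : ℝ) (hα0 : 0 < α) (hα : α ≤ 1 / 2) {N : ℕ}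
    (Z : ℕ → Matrix (Fin N) (Fin N) ℂ) (q : ℕ) (hq : q < 4) (a b : Fin N) :
    Z q a b = ∑ t, ∑ s, star (rad α q t s) *
      (∑ q ∈ Finset.range 4, kron (Z q) (rad α q * A1 α)).submatrix finProdFinEquiv finProdFinEquiv
        (a, t) (b, s) := by
  simp only [Matrix.submatrix_apply, Matrix.sum_apply, Finset.mul_sum]
  have : ∀ k ∈ Finset.range 4, ∑ t, ∑ s, star (rad α q t s) *
      kron (Z k) (rad α k * A1 α) (finProdFinEquiv (a, t)) (finProdFinEquiv (b, s)) =
      if q = k then Z k a b else 0 := by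
    intro k hk
    rw [extract_kron, rad_orth α hα0 hα q hq k (Finset.mem_range.mp hk)]
    simp
  calc Z q a b = ∑ k ∈ Finset.range 4, if q = k then Z k a b else 0 := by simp [hq]
    _ = _ := by
      rw [← Finset.sum_congr rfl this, Finset.sum_comm]
      refine Finset.sum_congr rfl fun t _ => ?_
      rw [Finset.sum_comm]

theorem step (α : ℝ) (hα0 : 0 < α) (hα : α ≤ 1 / 2) :
    ∃ K : ℝ, 0 ≤ K ∧ ∀ (N : ℕ) (Z : ℕ → Matrix (Fin N) (Fin N) ℂ) (c : ℝ),
      NucLe (∑ q ∈ Finset.range 4, kron (Z q) (rad α q * A1 α)) c →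
      NucLe (Z 0) c ∧ ∀ q < 4, NucLe (Z q) (K * c) := by
  refine ⟨∑ q ∈ Finset.range 4, ∑ t, ∑ s, ‖rad α q t s‖, by positivity, ?_⟩
  intro N Z c h
  have hc := h.nonneg
  have h' := h.submatrix (finProdFinEquiv : Fin N × Fin 2 ≃ Fin (N * 2))
  constructor
  · convert h'.ptrace using 1
    ext a b
    rw [extract α hα0 hα Z 0 (by norm_num) a b]
    simp [rad, Matrix.one_apply]
  · intro q hq
    have h1 : NucLe (Z q) (∑ t, ∑ s, ‖rad α q t s‖ * c) := by
      have : Z q = ∑ t, ∑ s, star (rad α q t s) • (Matrix.of fun a b =>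
        (∑ q ∈ Finset.range 4, kron (Z q) (rad α q * A1 α)).submatrix finProdFinEquiv
          finProdFinEquiv (a, t) (b, s)) := by
        ext a b
        rw [extract α hα0 hα Z q hq a b]
        simp only [Matrix.sum_apply, Matrix.smul_apply, Matrix.of_apply, smul_eq_mul]
      rw [this]
      refine NucLe.sum _ _ _ fun t _ => NucLe.sum _ _ _ fun s _ => ?_
      simpa using (h'.slice t s).smul (star (rad α q t s))
    refine h1.mono ?_
    simp only [← Finset.sum_mul]
    gcongr
    exact Finset.single_le_sum (f := fun q => ∑ t, ∑ s, ‖rad α q t s‖)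
      (fun _ _ => by positivity) (Finset.mem_range.mpr hq)

theorem nuc_A1 (α : ℝ) (hα0 : 0 < α) (hα : α ≤ 1 / 2) : NucLe (rad α 0 * A1 α) 1 := by
  refine ⟨Fin 2, inferInstance, fun j => Pi.single j (A1 α j j), fun j => Pi.single j 1, ?_, ?_⟩
  · intro a b
    fin_cases a <;> fin_cases b <;> simp [rad, A1]
  · have h1 : |1 - α| = 1 - α := abs_of_pos (by linarith)
    have h2 : ‖(1 : ℂ) - α‖ = 1 - α := by
      have : (1 : ℂ) - α = ((1 - α : ℝ) : ℂ) := by push_cast; rfl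
      rw [this, Complex.norm_real, Real.norm_eq_abs, h1]
    simp [nrm, A1, abs_of_pos hα0, h2]

theorem full_mul (α : ℝ) (a : ℕ → ℂ) (ν : ℕ) : full (rad α) a (ν + 1) * Amat α (ν + 1) =
    ∑ q ∈ Finset.range 4, kron (comp (rad α) a ν q * Amat α ν) (rad α q * A1 α) := by
  rw [full_succ]
  refine Eq.trans (Finset.sum_mul (Finset.range 4)
    (fun q => kron (comp (rad α) a ν q) (rad α q)) (kron (Amat α ν) (A1 α))) ?_
  exact Finset.sum_congr rfl fun q _ => kron_mul _ _ _ _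

/-- Truncation of a coefficient sequence. -/
def trunc (p : ℕ) (a : ℕ → ℂ) : ℕ → ℂ := fun j => if j < p then a j else 0

theorem main_ind (α : ℝ) (hα0 : 0 < α) (hα : α ≤ 1 / 2) :
    ∃ C : ℝ, ∀ (ν : ℕ) (a : ℕ → ℂ) (p : ℕ) (c : ℝ),
      NucLe (full (rad α) a ν * Amat α ν) c →
      NucLe (full (rad α) (trunc p a) ν * Amat α ν) (C * c) := by
  obtain ⟨K, hK, hstep⟩ := step α hα0 hα
  have hL : ∀ q, NucLe (rad α q * A1 α) (schatten 1 (rad α q * A1 α)) :=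
    fun q => nucLe_schatten _
  have hL0 := fun q => (hL q).nonneg
  refine ⟨1 + ∑ q ∈ Finset.range 4, 3 * K * schatten 1 (rad α q * A1 α), ?_⟩
  set M := ∑ q ∈ Finset.range 4, 3 * K * schatten 1 (rad α q * A1 α) with hM
  have hM0 : 0 ≤ M := Finset.sum_nonneg fun q _ => mul_nonneg (by positivity) (hL0 q)
  intro ν
  induction ν with
  | zero =>
    intro a p c h
    have hc := h.nonneg
    by_cases hp : 0 < p
    · have : full (rad α) (trunc p a) 0 = full (rad α) a 0 := by simp [full, trunc, hp]
      rw [this]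
      exact h.mono (by nlinarith)
    · have : full (rad α) (trunc p a) 0 = 0 := by simp [full, trunc, hp]
      rw [this, Matrix.zero_mul]
      exact NucLe.zero.mono (by positivity)
  | succ ν ih =>
    intro a p c h
    have hc := h.nonneg
    rw [full_mul] at h ⊢
    obtain ⟨h0, hq⟩ := hstep _ _ _ h
    by_cases hp : p ≤ 4 ^ ν
    · have hz : ∀ q ∈ Finset.range 4, q ≠ 0 →
          kron (comp (rad α) (trunc p a) ν q * Amat α ν) (rad α q * A1 α) = 0 := by
        intro q _ h1
        have : comp (rad α) (trunc p a) ν q = 0 := by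
          rw [comp, if_neg h1]
          ext r s
          have : ¬ (4 ^ ν * q + shellNum r s < p) := by
            have : 1 ≤ q := by omega
            nlinarith
          simp [shellMat, trunc, this]
        rw [this, Matrix.zero_mul, kron_zero]
      rw [Finset.sum_eq_single 0 hz (by simp)]
      have := (ih a p c h0).kron (nuc_A1 α hα0 hα)
      rw [mul_one] at this
      exact this
    · refine NucLe.mono (NucLe.sum _ _ (fun q => (3 * (K * c)) * schatten 1 (rad α q * A1 α)) ?_)
        (d := (1 + M) * c) ?_
      · intro q hq4
        refine NucLe.kron ?_ (hL q)
        have hZ := hq q (Finset.mem_range.mp hq4)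
        by_cases h1 : q = 0
        · subst h1
          have : comp (rad α) (trunc p a) ν 0 = comp (rad α) a ν 0 := by
            simp only [comp, if_true, full]
            refine Finset.sum_congr rfl fun j hj => ?_
            have : j < p := by have := Finset.mem_range.mp hj; omega
            simp [trunc, this]
          rw [this]
          have := mul_nonneg hK hc
          exact hZ.mono (by linarith)
        · convert hZ.shell (p - 4 ^ ν * q) using 1
          obtain ⟨d, hd⟩ := Amat_diag_s14 α ν
          ext r s
          rw [hd]
          simp only [Matrix.of_apply, Matrix.mul_diagonal, comp, if_neg h1, shellMat, trunc]
          have : shellNum r s < p - 4 ^ ν * q ↔ 4 ^ ν * q + shellNum r s < p := by omega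
          simp only [this]
          split_ifs <;> simp
      · have : ∑ q ∈ Finset.range 4, (3 * (K * c)) * schatten 1 (rad α q * A1 α) = M * c := by
          rw [hM, Finset.sum_mul]
          refine Finset.sum_congr rfl fun q _ => ?_
          ring
        rw [this]
        linarith

/-- the Rademacher system satisfies `ρ_1(r_j^* r_k) = δ_{jk}` and `‖r_0‖ = 1`,
and the left Haar systems built from it are bases of `(N_ν, ‖·‖_♯)` with uniformly bounded
basis constants (the finite-level content of the Schauder basis theorem for the predual of
the hyperfinite factor of type III_λ, 0 < α < 1/2, resp. II₁ for α = 1/2). -/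
theorem rademacher_haar_uniform_basis
    (α : ℝ) (hα0 : 0 < α) (hα : α ≤ 1 / 2) :
    (∀ j < 4, ∀ k < 4, rho1 α ((rad α j)ᴴ * rad α k) = if j = k then 1 else 0) ∧
    opNorm (rad α 0) = 1 ∧
    ∃ C : ℝ, ∀ ν, 1 ≤ ν → ∀ m < 4 ^ ν, ∀ a : ℕ → ℂ,
      sharpNorm α (∑ j ∈ Finset.range (m + 1), a j • haar (rad α) ν j) ≤
        C * sharpNorm α (∑ j ∈ Finset.range (4 ^ ν), a j • haar (rad α) ν j) := by
  refine ⟨rad_orth α hα0 hα, opNorm_rad_zero α, ?_⟩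
  obtain ⟨C, hC⟩ := main_ind α hα0 hα
  refine ⟨C, fun ν _ m hm a => ?_⟩
  have h1 := schatten_le _ _ (hC ν a (m + 1) _ (nucLe_schatten _))
  have h2 : full (rad α) (trunc (m + 1) a) ν =
      ∑ j ∈ Finset.range (m + 1), a j • haar (rad α) ν j := by
    rw [full]
    symm
    rw [← Finset.sum_subset (Finset.range_subset_range.mpr (show m + 1 ≤ 4 ^ ν from hm))]
    · refine Finset.sum_congr rfl fun j hj => ?_
      rw [trunc, if_pos (Finset.mem_range.mp hj)]
    · intro j _ hj
      have : ¬ j < m + 1 := fun h => hj (Finset.mem_range.mpr h)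
      simp only [trunc, if_neg this, zero_smul]
  rw [h2] at h1
  exact h1

end
end
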